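/- arXiv:1705.07306 — 10 statements merged into one kernel-verified Lean document; each statement's English description precedes it below -/
import Mathlib

section
/- For every real θ > 0, υ(θ⁻¹) = inf{c > 0 : there exist infinitely many positive integers m such that m·(⌈mθ⌉ − mθ) < c}. -/
/-- The one-sided Markov constant
`υ(θ) := inf {c > 0 : ∃∞ (p,q) ∈ ℤ², q ≠ 0, 0 < θ - p/q < c/q²}`. -/
noncomputable def upsilon (θ : ℝ) : ℝ :=
  sInf {c : ℝ | 0 < c ∧
    {pq : ℤ × ℤ | pq.2 ≠ 0 ∧ 0 < θ - (pq.1 : ℝ) / (pq.2 : ℝ) ∧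
      θ - (pq.1 : ℝ) / (pq.2 : ℝ) < c / (pq.2 : ℝ) ^ 2}.Infinite}

theorem exists_large_denominator_of_infinite {α c : ℝ}
    (h : {pq : ℤ × ℤ | pq.2 ≠ 0 ∧ 0 < α - (pq.1 : ℝ) / (pq.2 : ℝ) ∧
      α - (pq.1 : ℝ) / (pq.2 : ℝ) < c / (pq.2 : ℝ) ^ 2}.Infinite) (Q : ℝ) :
    ∃ p q : ℤ, Q < q ∧ 0 < q ∧ 0 < q * α - p ∧ q * (q * α - p) < c := by
  have normalize : ∀ p q : ℤ, q ≠ 0 → 0 < α - (p : ℝ) / q → α - (p : ℝ) / q < c / (q : ℝ) ^ 2 →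
      ∃ p' q' : ℤ, q' = |q| ∧ |p'| = |p| ∧ 0 < q' ∧ 0 < q' * α - p' ∧ q' * (q' * α - p') < c := by
    intro p q hq h₁ h₂
    have hq' : (q : ℝ) ≠ 0 := by exact_mod_cast hq
    have hsq : 0 < (q : ℝ) ^ 2 := by positivity
    rw [lt_div_iff₀ hsq] at h₂
    have e : (α - (p : ℝ) / q) * (q : ℝ) ^ 2 = q * (q * α - p) := by field_simp
    have h₃ := mul_pos h₁ hsq
    rw [e] at h₂ h₃
    rcases lt_or_gt_of_ne hq with hneg | hpos
    · have hneg' : (q : ℝ) < 0 := by exact_mod_cast hneg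
      refine ⟨-p, -q, (abs_of_neg hneg).symm, abs_neg p, by omega, ?_, ?_⟩ <;> push_cast <;> nlinarith
    · have hpos' : (0 : ℝ) < q := by exact_mod_cast hpos
      exact ⟨p, q, (abs_of_pos hpos).symm, rfl, hpos, pos_of_mul_pos_right h₃ hpos'.le, h₂⟩
  by_contra! hbdd
  obtain ⟨K, hK⟩ := exists_nat_gt Q
  obtain ⟨L, hL⟩ := exists_nat_gt (K * |α| + |c|)
  refine h ((Set.finite_Icc ((-L, -K) : ℤ × ℤ) (L, K)).subset ?_)
  rintro ⟨p, q⟩ ⟨hq, h₁, h₂⟩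
  obtain ⟨p', q', hqq, hpp, hpos, h₃, h₄⟩ := normalize p q hq h₁ h₂
  have hqQ : (q' : ℝ) ≤ Q := by
    by_contra! hlt
    exact absurd h₄ (not_lt.mpr (hbdd p' q' hlt hpos h₃))
  have hqK : (q' : ℝ) ≤ K := hqQ.trans hK.le
  have hone : (1 : ℝ) ≤ q' := by exact_mod_cast hpos
  have hmul : |(q' : ℝ) * α| ≤ K * |α| := by
    rw [abs_mul, abs_of_pos (by linarith : (0 : ℝ) < q')]
    gcongr
  have hp : |(p' : ℝ)| ≤ L := by
    have := abs_le.mp hmul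
    have := le_abs_self c
    have := abs_nonneg c
    rw [abs_le]
    constructor <;> nlinarith
  have hpL : |p| ≤ (L : ℤ) := by
    rw [← hpp]
    exact_mod_cast hp
  have hqK' : |q| ≤ (K : ℤ) := by
    rw [← hqq]
    exact_mod_cast hqK
  rw [abs_le] at hpL hqK'
  exact ⟨⟨hpL.1, hqK'.1⟩, ⟨hpL.2, hqK'.2⟩⟩

theorem infinite_mul_ceil_sub_lt {θ c : ℝ} (hθ : 0 < θ)
    (h : {pq : ℤ × ℤ | pq.2 ≠ 0 ∧ 0 < θ⁻¹ - (pq.1 : ℝ) / (pq.2 : ℝ) ∧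
      θ⁻¹ - (pq.1 : ℝ) / (pq.2 : ℝ) < c / (pq.2 : ℝ) ^ 2}.Infinite) :
    {m : ℕ | 0 < m ∧ (m : ℝ) * ((⌈(m : ℝ) * θ⌉ : ℝ) - (m : ℝ) * θ) < c}.Infinite := by
  refine Set.infinite_of_forall_exists_gt fun N => ?_
  obtain ⟨p, q, hQ, hq, h₁, h₂⟩ := exists_large_denominator_of_infinite h (θ * (c + N))
  have hone : (1 : ℝ) ≤ q := by exact_mod_cast hq
  have hlarge : c + N < q * θ⁻¹ := by
    rw [← div_eq_mul_inv, lt_div_iff₀ hθ]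
    linarith
  have hNp : (N : ℝ) < p := by nlinarith
  have hp : (N : ℤ) < p := by exact_mod_cast hNp
  lift p to ℕ using by omega with m
  have hNm : N < m := by exact_mod_cast hp
  rw [Int.cast_natCast] at h₁ h₂ hNp
  refine ⟨m, ⟨by omega, ?_⟩, hNm⟩
  have e : (q : ℝ) * θ⁻¹ * θ = q := inv_mul_cancel_right₀ hθ.ne' _
  have hmq : (m : ℝ) * θ ≤ q := by nlinarith
  have hceil : (⌈(m : ℝ) * θ⌉ : ℝ) ≤ q := by exact_mod_cast Int.ceil_le.mpr hmq
  calc (m : ℝ) * (⌈(m : ℝ) * θ⌉ - m * θ) ≤ (q * θ⁻¹) * (q - m * θ) := by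
        gcongr <;> linarith [Int.le_ceil ((m : ℝ) * θ)]
    _ = q * (q * θ⁻¹ - m) := by field_simp
    _ < c := h₂

theorem infinite_lower_approximations_of_irrational {θ c ε : ℝ} (hθ : 0 < θ)
    (hirr : Irrational θ) (hε : 0 < ε)
    (h : {m : ℕ | 0 < m ∧ (m : ℝ) * ((⌈(m : ℝ) * θ⌉ : ℝ) - (m : ℝ) * θ) < c}.Infinite) :
    {pq : ℤ × ℤ | pq.2 ≠ 0 ∧ 0 < θ⁻¹ - (pq.1 : ℝ) / (pq.2 : ℝ) ∧
      θ⁻¹ - (pq.1 : ℝ) / (pq.2 : ℝ) < (c + ε) / (pq.2 : ℝ) ^ 2}.Infinite := by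
  obtain ⟨N, hN⟩ := exists_nat_gt (c / (ε * θ))
  rw [div_lt_iff₀ (by positivity)] at hN
  have hinj : Function.Injective fun m : ℕ => ((m : ℤ), ⌈(m : ℝ) * θ⌉) := fun a b hab => by
    simpa using congrArg Prod.fst hab
  refine ((h.sdiff (Set.finite_Iic N)).image hinj.injOn).mono ?_
  rintro _ ⟨m, ⟨⟨hm, hc⟩, hmN⟩, rfl⟩
  have hNm : (N : ℝ) < m := by exact_mod_cast not_le.mp hmN
  have hm₁ : (1 : ℝ) ≤ m := by exact_mod_cast hm
  have hne : (m : ℝ) * θ ≠ ⌈(m : ℝ) * θ⌉ := (hirr.natCast_mul hm.ne').ne_int _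
  have hlt : (m : ℝ) * θ < ⌈(m : ℝ) * θ⌉ := lt_of_le_of_ne (Int.le_ceil _) hne
  have hlt₁ := Int.ceil_lt_add_one ((m : ℝ) * θ)
  dsimp only [Set.mem_ofPred_eq]
  set n := ⌈(m : ℝ) * θ⌉
  have hn : (0 : ℝ) < n := lt_trans (by positivity) hlt
  have e : θ⁻¹ - ((m : ℤ) : ℝ) / n = (n - m * θ) / (θ * n) := by
    push_cast
    field_simp
  refine ⟨by exact_mod_cast hn.ne', ?_, ?_⟩
  · rw [e]
    have := sub_pos.mpr hlt
    positivity
  · rw [e, div_lt_div_iff₀ (by positivity) (by positivity)]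
    have hsmall : (n : ℝ) - m * θ < ε * θ := by
      have : (m : ℝ) * (n - m * θ) < m * (ε * θ) := by
        have : (N : ℝ) * (ε * θ) ≤ m * (ε * θ) := by gcongr
        linarith
      exact lt_of_mul_lt_mul_left this (by linarith)
    have hkey : (n : ℝ) * (n - m * θ) < (c + ε) * θ := by
      nlinarith [mul_lt_mul_of_pos_left hc hθ]
    nlinarith [mul_lt_mul_of_pos_right hkey hn]

theorem finite_lower_approximations_of_rational (r : ℚ) (c : ℝ) :
    {pq : ℤ × ℤ | pq.2 ≠ 0 ∧ 0 < (r : ℝ) - (pq.1 : ℝ) / (pq.2 : ℝ) ∧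
      (r : ℝ) - (pq.1 : ℝ) / (pq.2 : ℝ) < c / (pq.2 : ℝ) ^ 2}.Finite := by
  by_contra h
  obtain ⟨p, q, hQ, hq, h₁, h₂⟩ := exists_large_denominator_of_infinite h (c * r.den)
  have hd : (0 : ℝ) < r.den := by exact_mod_cast r.den_pos
  have hq' : (0 : ℝ) < q := by exact_mod_cast hq
  have hr : (r : ℝ) * r.den = r.num := by exact_mod_cast Rat.mul_den_eq_num r
  have e : ((q * r.num - p * r.den : ℤ) : ℝ) = (q * r - p) * r.den := by
    push_cast
    rw [← hr]
    ring
  have hone : (1 : ℝ) ≤ (q * r - p) * r.den := by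
    rw [← e]
    have : (0 : ℝ) < ((q * r.num - p * r.den : ℤ) : ℝ) := e ▸ mul_pos h₁ hd
    exact_mod_cast (Int.cast_pos.mp this : 0 < q * r.num - p * r.den)
  nlinarith [mul_lt_mul_of_pos_right h₂ hd]

theorem infinite_mul_ceil_sub_lt_of_rational (r : ℚ) {c : ℝ} (hc : 0 < c) :
    {m : ℕ | 0 < m ∧ (m : ℝ) * ((⌈(m : ℝ) * r⌉ : ℝ) - (m : ℝ) * r) < c}.Infinite := by
  refine Set.infinite_of_forall_exists_gt fun N => ?_
  have hd := r.den_pos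
  refine ⟨(N + 1) * r.den, ⟨by positivity, ?_⟩, by nlinarith⟩
  have hr : (r : ℝ) * r.den = r.num := by exact_mod_cast Rat.mul_den_eq_num r
  have e : (((N + 1) * r.den : ℕ) : ℝ) * r = (((N + 1) * r.num : ℤ) : ℝ) := by
    push_cast
    rw [← hr]
    ring
  rw [e, Int.ceil_intCast, sub_self, mul_zero]
  exact hc

theorem upsilon_inv_eq_inf_ceil (θ : ℝ) (hθ : 0 < θ) :
    upsilon θ⁻¹ =
      sInf {c : ℝ | 0 < c ∧
        {m : ℕ | 0 < m ∧ (m : ℝ) * ((⌈(m : ℝ) * θ⌉ : ℝ) - (m : ℝ) * θ) < c}.Infinite} := by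
  unfold upsilon
  by_cases hirr : Irrational θ
  · set A := {c : ℝ | 0 < c ∧ {pq : ℤ × ℤ | pq.2 ≠ 0 ∧ 0 < θ⁻¹ - (pq.1 : ℝ) / (pq.2 : ℝ) ∧
      θ⁻¹ - (pq.1 : ℝ) / (pq.2 : ℝ) < c / (pq.2 : ℝ) ^ 2}.Infinite}
    set B := {c : ℝ | 0 < c ∧
      {m : ℕ | 0 < m ∧ (m : ℝ) * ((⌈(m : ℝ) * θ⌉ : ℝ) - (m : ℝ) * θ) < c}.Infinite}
    have hAB : A ⊆ B := fun c hc => ⟨hc.1, infinite_mul_ceil_sub_lt hθ hc.2⟩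
    have hBA : ∀ c ∈ B, ∀ ε > 0, c + ε ∈ A := fun c hc ε hε =>
      ⟨add_pos hc.1 hε, infinite_lower_approximations_of_irrational hθ hirr hε hc.2⟩
    have hA₀ : BddBelow A := ⟨0, fun c hc => hc.1.le⟩
    have hB₀ : BddBelow B := ⟨0, fun c hc => hc.1.le⟩
    rcases B.eq_empty_or_nonempty with hB | hB
    · rw [Set.subset_empty_iff.mp (hAB.trans hB.subset), hB]
    · have hA : A.Nonempty := hB.imp' (· + 1) fun c hc => hBA c hc 1 one_pos
      refine le_antisymm (le_csInf hB fun c hc => ?_) (csInf_le_csInf hB₀ hA hAB)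
      exact le_of_forall_pos_le_add fun ε hε => csInf_le hA₀ (hBA c hc ε hε)
  · obtain ⟨r, rfl⟩ := not_not.mp hirr
    -- The left-hand set is empty here, and `sInf ∅ = 0`.
    have hA : {c : ℝ | 0 < c ∧ {pq : ℤ × ℤ | pq.2 ≠ 0 ∧
        0 < (r : ℝ)⁻¹ - (pq.1 : ℝ) / (pq.2 : ℝ) ∧
        (r : ℝ)⁻¹ - (pq.1 : ℝ) / (pq.2 : ℝ) < c / (pq.2 : ℝ) ^ 2}.Infinite} = ∅ := by
      refine Set.eq_empty_of_forall_notMem fun c hc => hc.2 ?_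
      exact_mod_cast finite_lower_approximations_of_rational r⁻¹ c
    have hB : {c : ℝ | 0 < c ∧ {m : ℕ | 0 < m ∧
        (m : ℝ) * ((⌈(m : ℝ) * r⌉ : ℝ) - (m : ℝ) * r) < c}.Infinite} = Set.Ioi 0 :=
      Set.ext fun c => and_iff_left_of_imp fun hc => infinite_mul_ceil_sub_lt_of_rational r hc
    rw [hA, hB, Real.sInf_empty, csInf_Ioi]
end

section
/- For every real θ > 0, μ(θ) = min{υ(θ), υ(θ⁻¹)}. -/
/-- The Markov constant
`μ(θ) := inf {c > 0 : ∃∞ (p,q) ∈ ℤ², q ≠ 0, |θ - p/q| < c/q²}`. -/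
noncomputable def markov (θ : ℝ) : ℝ :=
  sInf {c : ℝ | 0 < c ∧
    {pq : ℤ × ℤ | pq.2 ≠ 0 ∧
      |θ - (pq.1 : ℝ) / (pq.2 : ℝ)| < c / (pq.2 : ℝ) ^ 2}.Infinite}

/-- The fractions `p / q` approximating `θ` to within `c / q ^ 2` from the side prescribed by the
sign `σ`: from below for `σ = 1` and from above for `σ = -1`. -/
def sidedApprox (σ θ c : ℝ) : Set (ℤ × ℤ) :=
  {pq | pq.2 ≠ 0 ∧ 0 < σ * (θ - (pq.1 : ℝ) / (pq.2 : ℝ)) ∧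
    σ * (θ - (pq.1 : ℝ) / (pq.2 : ℝ)) < c / (pq.2 : ℝ) ^ 2}

/-- The positive constants `c` admitting infinitely many approximations in `sidedApprox σ θ c`. -/
def sidedConstants (σ θ : ℝ) : Set ℝ :=
  {c | 0 < c ∧ (sidedApprox σ θ c).Infinite}

theorem upsilon_eq_sInf_sidedConstants (θ : ℝ) : upsilon θ = sInf (sidedConstants 1 θ) := by
  simp only [upsilon, sidedConstants, sidedApprox, one_mul]

theorem bddBelow_sidedConstants (σ θ : ℝ) : BddBelow (sidedConstants σ θ) :=
  ⟨0, fun _ hc => hc.1.le⟩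

theorem finite_approx_of_denom_le (θ c N : ℝ) :
    {pq : ℤ × ℤ | pq.2 ≠ 0 ∧ |θ - (pq.1 : ℝ) / (pq.2 : ℝ)| < c / (pq.2 : ℝ) ^ 2 ∧
      |(pq.2 : ℝ)| ≤ N}.Finite := by
  obtain ⟨M, hM⟩ := exists_nat_ge (N * |θ| + c)
  obtain ⟨K, hK⟩ := exists_nat_ge N
  refine ((Set.finite_Icc (-(M : ℤ)) M).prod (Set.finite_Icc (-(K : ℤ)) K)).subset ?_
  rintro ⟨p, q⟩ ⟨hq, h, hN⟩
  simp only at hq h hN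
  have hq1 : (1 : ℝ) ≤ |(q : ℝ)| := by exact_mod_cast Int.one_le_abs hq
  have hq0 : (q : ℝ) ≠ 0 := by exact_mod_cast hq
  rw [lt_div_iff₀ (by positivity), ← sq_abs (q : ℝ)] at h
  have hmul : |θ - (p : ℝ) / q| * |(q : ℝ)| = |θ * q - p| := by
    rw [← abs_mul, sub_mul, div_mul_cancel₀ _ hq0]
  have h1 : |θ * q - p| ≤ c := by
    nlinarith [abs_nonneg (θ * q - p)]
  have h2 : |(p : ℝ)| ≤ M := by
    have h3 : |(p : ℝ)| ≤ |θ * q| + |θ * q - p| := by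
      have := abs_sub (θ * q) (θ * q - p)
      rwa [sub_sub_cancel] at this
    rw [abs_mul] at h3
    nlinarith [mul_le_mul_of_nonneg_left hN (abs_nonneg θ)]
  have h4 : |(q : ℝ)| ≤ K := hN.trans hK
  simp only [Set.mem_prod, Set.mem_Icc]
  rw [abs_le] at h2 h4
  exact_mod_cast And.intro h2 h4

theorem abs_sub_lt_of_mem_sidedApprox {σ θ c : ℝ} (hσ : |σ| = 1) {pq : ℤ × ℤ}
    (h : pq ∈ sidedApprox σ θ c) :
    |θ - (pq.1 : ℝ) / (pq.2 : ℝ)| < c / (pq.2 : ℝ) ^ 2 := by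
  have h' := h.2.2
  rwa [← abs_of_pos h.2.1, abs_mul, hσ, one_mul] at h'

theorem infinite_sidedApprox_denom_gt {σ θ c : ℝ} (hσ : |σ| = 1)
    (h : (sidedApprox σ θ c).Infinite) (N : ℝ) :
    {pq ∈ sidedApprox σ θ c | N < |(pq.2 : ℝ)|}.Infinite := by
  refine (h.sdiff (finite_approx_of_denom_le θ c N)).mono ?_
  rintro pq ⟨hpq, hN⟩
  refine ⟨hpq, ?_⟩
  by_contra! hle
  exact hN ⟨hpq.1, abs_sub_lt_of_mem_sidedApprox hσ hpq, hle⟩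

theorem mem_sidedConstants_inv {σ θ c c' : ℝ} (hσ : |σ| = 1) (hθ : 0 < θ) (hc' : c < c')
    (h : c ∈ sidedConstants σ θ) : c' ∈ sidedConstants (-σ) θ⁻¹ := by
  obtain ⟨hc, hinf⟩ := h
  refine ⟨hc.trans hc', ?_⟩
  have hδ : 0 < min θ ((c' - c) * θ / c) :=
    lt_min hθ (div_pos (mul_pos (sub_pos.2 hc') hθ) hc)
  set δ := min θ ((c' - c) * θ / c)
  have hlarge := infinite_sidedApprox_denom_gt hσ hinf (max 1 (c / δ))
  refine (hlarge.image (f := Prod.swap) Prod.swap_injective.injOn).mono ?_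
  rintro _ ⟨⟨p, q⟩, ⟨hpq, hN⟩, rfl⟩
  have habs := abs_sub_lt_of_mem_sidedApprox hσ hpq
  obtain ⟨hq, hpos, hlt⟩ := hpq
  simp only [Prod.fst_swap, Prod.snd_swap, sidedApprox, Set.mem_ofPred_eq] at *
  have hq0 : (q : ℝ) ≠ 0 := by exact_mod_cast hq
  have hq1 : 1 < |(q : ℝ)| := (le_max_left _ _).trans_lt hN
  have hqδ : c / δ < |(q : ℝ)| := (le_max_right _ _).trans_lt hN
  obtain ⟨t, ht⟩ : ∃ t : ℝ, t = (p : ℝ) / q := ⟨_, rfl⟩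
  rw [← ht] at habs hpos hlt
  have hclose : |θ - t| < δ := by
    refine habs.trans ?_
    rw [div_lt_iff₀ hδ] at hqδ
    rw [div_lt_iff₀ (by positivity), ← sq_abs (q : ℝ)]
    nlinarith
  have h1 : |θ - t| < θ := hclose.trans_le (min_le_left _ _)
  have h2 : |θ - t| < (c' - c) * θ / c := hclose.trans_le (min_le_right _ _)
  rw [lt_div_iff₀ hc] at h2
  have ht0 : 0 < t := by linarith [le_abs_self (θ - t)]
  have h3 : c * t < c' * θ := by nlinarith [neg_abs_le (θ - t)]
  have hp : (p : ℝ) = t * q := by rw [ht, div_mul_cancel₀ _ hq0]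
  have hp0 : (p : ℝ) ≠ 0 := by rw [hp]; positivity
  have hinv : -σ * (θ⁻¹ - (q : ℝ) / p) = σ * (θ - t) / (t * θ) := by
    rw [hp]; field_simp; ring
  refine ⟨by exact_mod_cast hp0, ?_, ?_⟩
  · rw [hinv]; positivity
  · rw [hinv, hp]
    calc σ * (θ - t) / (t * θ) < c / (q : ℝ) ^ 2 / (t * θ) := by gcongr
      _ ≤ c' / (t * q) ^ 2 := by
        rw [div_div, div_le_div_iff₀ (by positivity) (by positivity)]
        have : 0 ≤ (q : ℝ) ^ 2 * t := by positivity
        nlinarith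

theorem sInf_sidedConstants_inv_le {σ θ : ℝ} (hσ : |σ| = 1) (hθ : 0 < θ)
    (hne : (sidedConstants σ θ).Nonempty) :
    sInf (sidedConstants (-σ) θ⁻¹) ≤ sInf (sidedConstants σ θ) :=
  le_csInf hne fun _ hc => le_of_forall_gt_imp_ge_of_dense fun _ hc' =>
    csInf_le (bddBelow_sidedConstants _ _) (mem_sidedConstants_inv hσ hθ hc' hc)

/-- A fraction exceeding `θ` by less than `1 / q ^ 2` has a neighbour `p' / q'` with
`0 < q' ≤ q` which approximates `θ` from below. -/
theorem exists_lower_neighbour {θ : ℝ} {p q : ℤ} (hq : 0 < q) (hcop : IsCoprime p q)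
    (hθ : θ < (p : ℝ) / q) (h : (p : ℝ) / q - θ < 1 / (q : ℝ) ^ 2) :
    ∃ p' q' : ℤ, 0 < q' ∧ q' ≤ q ∧ 0 < θ - (p' : ℝ) / q' ∧ θ - (p' : ℝ) / q' < 1 / (q * q') := by
  obtain ⟨u, v, huv⟩ := hcop
  obtain ⟨a, b, ha0, haq, hab⟩ : ∃ a b : ℤ, 0 < a ∧ a ≤ q ∧ p * a - b * q = 1 := by
    have hdiv := Int.emod_add_mul_ediv (u - 1) q
    refine ⟨(u - 1) % q + 1, -v - p * ((u - 1) / q), ?_, ?_, ?_⟩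
    · linarith [Int.emod_nonneg (u - 1) hq.ne']
    · exact Int.emod_lt_of_pos _ hq
    · linear_combination huv + p * hdiv
  refine ⟨b, a, ha0, haq, ?_⟩
  have hqR : (0 : ℝ) < q := by exact_mod_cast hq
  have haR : (0 : ℝ) < a := by exact_mod_cast ha0
  have hle : (a : ℝ) ≤ q := by exact_mod_cast haq
  have hdet : (p : ℝ) * a - b * q = 1 := by exact_mod_cast hab
  have hsub : (p : ℝ) / q - (b : ℝ) / a = 1 / (q * a) := by
    field_simp; linarith
  have hcmp : 1 / (q : ℝ) ^ 2 ≤ 1 / (q * a) := by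
    rw [pow_two]; gcongr
  constructor <;> linarith

theorem Irrational.exists_isCoprime_abs_sub_lt {θ : ℝ} (hθ : Irrational θ) (N : ℝ) :
    ∃ p q : ℤ, 0 < q ∧ N < q ∧ IsCoprime p q ∧ |θ - (p : ℝ) / q| < 1 / (q : ℝ) ^ 2 := by
  have hinf := Real.infinite_rat_abs_sub_lt_one_div_den_sq_of_irrational hθ
  have hinj : Function.Injective fun r : ℚ => (r.num, (r.den : ℤ)) := by
    intro r s h
    simp only [Prod.mk.injEq, Nat.cast_inj] at h
    exact Rat.ext h.1 h.2
  obtain ⟨_, ⟨r, hr, rfl⟩, hN⟩ := ((hinf.image hinj.injOn).sdiff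
    (finite_approx_of_denom_le θ 1 N)).nonempty
  have hr' : |θ - (r.num : ℝ) / ((r.den : ℤ) : ℝ)| < 1 / ((r.den : ℤ) : ℝ) ^ 2 := by
    have h := hr.out
    rw [Rat.cast_def] at h
    simpa only [Int.cast_natCast] using h
  refine ⟨r.num, r.den, by exact_mod_cast r.pos, ?_, r.isCoprime_num_den, hr'⟩
  by_contra! hle
  refine hN ⟨Int.natCast_ne_zero.2 r.den_ne_zero, hr', ?_⟩
  simpa using hle

theorem Irrational.exists_mem_sidedApprox_lt {θ : ℝ} (hθ : Irrational θ) {ε : ℝ} (hε : 0 < ε) :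
    ∃ pq ∈ sidedApprox 1 θ 1, θ - (pq.1 : ℝ) / (pq.2 : ℝ) < ε := by
  obtain ⟨p, q, hq, hN, hcop, h⟩ := hθ.exists_isCoprime_abs_sub_lt (1 / ε)
  have hqR : (1 : ℝ) ≤ q := by exact_mod_cast hq
  have hqε : 1 / (q : ℝ) < ε := by
    rw [div_lt_iff₀ hε] at hN
    rw [div_lt_iff₀ (by positivity)]
    linarith
  rcases lt_or_ge ((p : ℝ) / q) θ with hlt | hge
  · rw [abs_of_pos (sub_pos.2 hlt)] at h
    refine ⟨(p, q), ⟨hq.ne', ?_, ?_⟩, ?_⟩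
    · simpa using hlt
    · simpa using h
    · refine h.trans (lt_of_le_of_lt ?_ hqε)
      gcongr
      nlinarith
  · have hne : θ ≠ (p : ℝ) / q := by
      have := hθ.ne_rat ((p : ℚ) / q)
      push_cast at this
      exact this
    rw [abs_sub_comm, abs_of_nonneg (sub_nonneg.2 hge)] at h
    obtain ⟨b, a, ha, haq, hpos, hlt⟩ :=
      exists_lower_neighbour hq hcop (lt_of_le_of_ne hge hne) h
    have haR : (1 : ℝ) ≤ a := by exact_mod_cast ha
    have hle : (a : ℝ) ≤ q := by exact_mod_cast haq
    refine ⟨(b, a), ⟨ha.ne', by simpa using hpos, ?_⟩, ?_⟩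
    · rw [one_mul]
      refine hlt.trans_le ?_
      simp only [pow_two]
      gcongr
    · refine hlt.trans (lt_of_le_of_lt ?_ hqε)
      gcongr
      nlinarith

theorem Irrational.one_mem_sidedConstants_one {θ : ℝ} (hθ : Irrational θ) :
    1 ∈ sidedConstants 1 θ := by
  refine ⟨one_pos, fun hfin => ?_⟩
  obtain ⟨pq₀, hpq₀, -⟩ := hθ.exists_mem_sidedApprox_lt one_pos
  obtain ⟨m, hm, hmin⟩ := hfin.exists_minimalFor
    (fun pq : ℤ × ℤ => θ - (pq.1 : ℝ) / (pq.2 : ℝ)) _ ⟨pq₀, hpq₀⟩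
  have hpos := hm.2.1
  rw [one_mul] at hpos
  obtain ⟨n, hn, hlt⟩ := hθ.exists_mem_sidedApprox_lt hpos
  exact absurd (hmin hn hlt.le) (not_le.2 hlt)

theorem Irrational.one_mem_sidedConstants_neg_one {θ : ℝ} (hθ : Irrational θ) :
    1 ∈ sidedConstants (-1) θ := by
  refine ⟨one_pos, ?_⟩
  have hinj : Function.Injective fun pq : ℤ × ℤ => (-pq.1, pq.2) := by
    rintro ⟨a, b⟩ ⟨c, d⟩ h
    simpa using h
  refine (hθ.neg.one_mem_sidedConstants_one.2.image hinj.injOn).mono ?_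
  rintro _ ⟨⟨p, q⟩, ⟨hq, hpos, hlt⟩, rfl⟩
  have h : -1 * (θ - ((-p : ℤ) : ℝ) / (q : ℝ)) = 1 * (-θ - (p : ℝ) / (q : ℝ)) := by
    push_cast; ring
  exact ⟨hq, h ▸ hpos, h ▸ hlt⟩

theorem Irrational.markov_eq_sInf_union {θ : ℝ} (hθ : Irrational θ) :
    markov θ = sInf (sidedConstants 1 θ ∪ sidedConstants (-1) θ) := by
  have hset (c : ℝ) : {pq : ℤ × ℤ | pq.2 ≠ 0 ∧
      |θ - (pq.1 : ℝ) / (pq.2 : ℝ)| < c / (pq.2 : ℝ) ^ 2} =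
      sidedApprox 1 θ c ∪ sidedApprox (-1) θ c := by
    ext pq
    constructor
    · rintro ⟨hq, h⟩
      have hne : θ ≠ (pq.1 : ℝ) / (pq.2 : ℝ) := by
        have := hθ.ne_rat ((pq.1 : ℚ) / pq.2)
        push_cast at this
        exact this
      rw [abs_lt] at h
      rcases hne.lt_or_gt with hlt | hgt
      · exact Or.inr ⟨hq, by linarith, by linarith⟩
      · exact Or.inl ⟨hq, by linarith, by linarith⟩
    · rintro (h | h)
      · exact ⟨h.1, abs_sub_lt_of_mem_sidedApprox (by simp) h⟩
      · exact ⟨h.1, abs_sub_lt_of_mem_sidedApprox (by simp) h⟩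
  unfold markov
  congr 1
  ext c
  simp only [hset, Set.infinite_union, sidedConstants, Set.mem_union, Set.mem_ofPred_eq]
  tauto

theorem upsilon_ratCast (r : ℚ) : upsilon r = 0 := by
  rw [upsilon_eq_sInf_sidedConstants]
  convert Real.sInf_empty
  refine Set.eq_empty_iff_forall_notMem.2 fun c ⟨hc, hinf⟩ => ?_
  obtain ⟨⟨p, q⟩, ⟨hq, hpos, hlt⟩, hN⟩ :=
    (infinite_sidedApprox_denom_gt (by simp) hinf (c * r.den)).nonempty
  simp only [one_mul] at hq hpos hlt hN
  have hq0 : (q : ℝ) ≠ 0 := by exact_mod_cast hq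
  have hd : (0 : ℝ) < r.den := by exact_mod_cast r.pos
  have hqa : 0 < |(q : ℝ)| := abs_pos.2 hq0
  have hprod : ((r : ℝ) - (p : ℝ) / q) * (r.den * q) = ((r.num * q - p * r.den : ℤ) : ℝ) := by
    rw [Rat.cast_def]
    push_cast
    field_simp
  have hint : (1 : ℝ) ≤ ((r : ℝ) - (p : ℝ) / q) * (r.den * |(q : ℝ)|) := by
    have habs : ((r : ℝ) - (p : ℝ) / q) * (r.den * |(q : ℝ)|) =
        |((r.num * q - p * r.den : ℤ) : ℝ)| := by
      rw [← hprod, abs_mul, abs_mul, abs_of_pos hpos, abs_of_pos hd]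
    have hne : r.num * q - p * r.den ≠ 0 := by
      intro h0
      rw [h0, Int.cast_zero, abs_zero] at habs
      have : 0 < ((r : ℝ) - (p : ℝ) / q) * (r.den * |(q : ℝ)|) := by positivity
      linarith
    rw [habs]
    exact_mod_cast Int.one_le_abs hne
  rw [lt_div_iff₀ (by positivity), ← sq_abs (q : ℝ)] at hlt
  nlinarith

theorem markov_ratCast (r : ℚ) : markov r = 0 := by
  refine le_antisymm (le_of_forall_gt_imp_ge_of_dense fun c hc => ?_)
    (Real.sInf_nonneg fun _ h => h.1.le)
  refine csInf_le ⟨0, fun _ h => h.1.le⟩ ⟨hc, ?_⟩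
  have hinj : Function.Injective fun n : ℕ => (r.num * (n + 1), (r.den : ℤ) * (n + 1)) := by
    intro m n h
    simpa [r.den_ne_zero] using (Prod.ext_iff.1 h).2
  refine (Set.infinite_range_of_injective hinj).mono ?_
  rintro _ ⟨n, rfl⟩
  have hn : (n : ℝ) + 1 ≠ 0 := by positivity
  refine ⟨?_, ?_⟩
  · have := r.pos
    positivity
  · have h0 : (r : ℝ) - (((r.num * (n + 1) : ℤ)) : ℝ) / (((r.den : ℤ) * (n + 1) : ℤ) : ℝ) = 0 := by
      push_cast
      rw [mul_div_mul_right _ _ hn, Rat.cast_def, sub_self]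
    rw [h0, abs_zero]
    push_cast
    positivity

theorem markov_eq_min_upsilon (θ : ℝ) (hθ : 0 < θ) :
    markov θ = min (upsilon θ) (upsilon θ⁻¹) := by
  by_cases hirr : Irrational θ
  · have hinv : sInf (sidedConstants (-1) θ) = sInf (sidedConstants 1 θ⁻¹) := by
      apply le_antisymm
      · simpa using sInf_sidedConstants_inv_le (σ := 1) (by simp) (inv_pos.2 hθ)
          ⟨1, hirr.inv.one_mem_sidedConstants_one⟩
      · simpa using sInf_sidedConstants_inv_le (σ := -1) (by simp) hθ
          ⟨1, hirr.one_mem_sidedConstants_neg_one⟩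
    rw [hirr.markov_eq_sInf_union, csInf_union (bddBelow_sidedConstants _ _)
      ⟨1, hirr.one_mem_sidedConstants_one⟩ (bddBelow_sidedConstants _ _)
      ⟨1, hirr.one_mem_sidedConstants_neg_one⟩, hinv, upsilon_eq_sInf_sidedConstants,
      upsilon_eq_sInf_sidedConstants]
  · obtain ⟨r, rfl⟩ := not_not.1 hirr
    rw [markov_ratCast, upsilon_ratCast, ← Rat.cast_inv, upsilon_ratCast, min_self]
end

section
/- Let θ be a positive irrational number. Every best approximation from below of the third kind to θ is a convergent of the regular continued fraction expansion of θ. -/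
/-- The coefficients `a₀, a₁, a₂, …` of the regular continued fraction expansion of `θ`. -/
noncomputable def cfA : ℝ → ℕ → ℤ
  | θ, 0 => ⌊θ⌋
  | θ, n + 1 => cfA (Int.fract θ)⁻¹ n

/-- Numerators of the convergents, shifted by one: `cfP θ (n+1) = pₙ`, with
`p₋₁ = 1`, `p₀ = a₀` and `pₙ = aₙ pₙ₋₁ + pₙ₋₂`. -/
noncomputable def cfP (θ : ℝ) : ℕ → ℤ
  | 0 => 1
  | 1 => ⌊θ⌋
  | n + 2 => cfA θ (n + 1) * cfP θ (n + 1) + cfP θ n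

/-- Denominators of the convergents, shifted by one: `cfQ θ (n+1) = qₙ`, with
`q₋₁ = 0`, `q₀ = 1` and `qₙ = aₙ qₙ₋₁ + qₙ₋₂`. -/
noncomputable def cfQ (θ : ℝ) : ℕ → ℤ
  | 0 => 0
  | 1 => 1
  | n + 2 => cfA θ (n + 1) * cfQ θ (n + 1) + cfQ θ n

/-- `p/q` (with `q > 0`) is a best approximation from below of the third kind to `θ`. -/
def IsBestBelowThird (θ : ℝ) (p q : ℤ) : Prop :=
  0 < q ∧ 0 ≤ (q : ℝ) * ((q : ℝ) * θ - (p : ℝ)) ∧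
    ∀ p' q' : ℤ, 0 < q' → q' ≤ q → (p' : ℝ) / (q' : ℝ) ≤ θ →
      (p' : ℝ) / (q' : ℝ) ≠ (p : ℝ) / (q : ℝ) →
      (q : ℝ) * ((q : ℝ) * θ - (p : ℝ)) < (q' : ℝ) * ((q' : ℝ) * θ - (p' : ℝ))

/-- The complete quotients of `θ`: iterate `θ ↦ 1 / fract θ`. -/
noncomputable def cfTail (θ : ℝ) : ℕ → ℝ
  | 0 => θ
  | n + 1 => (Int.fract (cfTail θ n))⁻¹

theorem cfTail_succ' (θ : ℝ) (n : ℕ) : cfTail θ (n + 1) = cfTail (Int.fract θ)⁻¹ n := by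
  induction n with
  | zero => rfl
  | succ n ih => rw [cfTail, ih, cfTail]

theorem cfA_eq_floor_cfTail (θ : ℝ) (n : ℕ) : cfA θ n = ⌊cfTail θ n⌋ := by
  induction n generalizing θ with
  | zero => rfl
  | succ n ih => rw [cfA, ih, cfTail_succ']

theorem Irrational.fract {θ : ℝ} (hθ : Irrational θ) : Irrational (Int.fract θ) := by
  rw [Int.fract]
  exact hθ.sub_intCast _

theorem Irrational.fract_pos {θ : ℝ} (hθ : Irrational θ) : 0 < Int.fract θ :=
  lt_of_le_of_ne (Int.fract_nonneg θ) hθ.fract.ne_zero.symm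

theorem irrational_cfTail {θ : ℝ} (hθ : Irrational θ) (n : ℕ) : Irrational (cfTail θ n) := by
  induction n with
  | zero => exact hθ
  | succ n ih => exact ih.fract.inv

theorem one_le_cfA_succ {θ : ℝ} (hθ : Irrational θ) (n : ℕ) : 1 ≤ cfA θ (n + 1) := by
  rw [cfA_eq_floor_cfTail, Int.le_floor, cfTail, Int.cast_one]
  exact (one_le_inv₀ (irrational_cfTail hθ n).fract_pos).2 (Int.fract_lt_one _).le

theorem cfQ_nonneg {θ : ℝ} (hθ : Irrational θ) (n : ℕ) : 0 ≤ cfQ θ n ∧ 1 ≤ cfQ θ (n + 1) := by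
  induction n with
  | zero => simp [cfQ]
  | succ n ih =>
    refine ⟨by linarith [ih.2], ?_⟩
    rw [cfQ]
    nlinarith [one_le_cfA_succ hθ n]

theorem cfQ_le_succ {θ : ℝ} (hθ : Irrational θ) (n : ℕ) : cfQ θ (n + 1) ≤ cfQ θ (n + 2) := by
  rw [cfQ]
  nlinarith [one_le_cfA_succ hθ n, cfQ_nonneg hθ n]

theorem lt_cfQ_two_mul_add_one {θ : ℝ} (hθ : Irrational θ) (k : ℕ) :
    (k : ℤ) < cfQ θ (2 * k + 1) := by
  induction k with
  | zero => simp [cfQ]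
  | succ k ih =>
    rw [show 2 * (k + 1) + 1 = (2 * k + 1) + 2 by ring, cfQ]
    push_cast
    nlinarith [one_le_cfA_succ hθ (2 * k + 1), (cfQ_nonneg hθ (2 * k + 1)).2]

theorem cfP_mul_cfQ_sub (θ : ℝ) (n : ℕ) :
    cfP θ (n + 1) * cfQ θ n - cfP θ n * cfQ θ (n + 1) = (-1) ^ (n + 1) := by
  induction n with
  | zero => simp [cfP, cfQ]
  | succ n ih =>
    rw [pow_succ, ← ih, cfP, cfQ]
    ring

theorem cfQ_mul_sub_cfP_succ {θ : ℝ} (hθ : Irrational θ) (n : ℕ) :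
    cfQ θ (n + 1) * θ - cfP θ (n + 1) = -(cfQ θ n * θ - cfP θ n) * Int.fract (cfTail θ n) := by
  induction n with
  | zero => simp [cfP, cfQ, cfTail]
  | succ n ih =>
    have hf := (irrational_cfTail hθ n).fract_pos.ne'
    have ht : cfTail θ (n + 1) * Int.fract (cfTail θ n) = 1 := inv_mul_cancel₀ hf
    have hprev : cfQ θ n * θ - cfP θ n =
        -(cfQ θ (n + 1) * θ - cfP θ (n + 1)) * cfTail θ (n + 1) := by
      rw [ih]
      linear_combination -(cfQ θ n * θ - cfP θ n) * ht
    rw [cfP, cfQ, cfA_eq_floor_cfTail, Int.fract]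
    push_cast
    linear_combination hprev

theorem cfQ_mul_sub_cfP_sign {θ : ℝ} (hθ : Irrational θ) (n : ℕ) :
    0 < (-1 : ℝ) ^ (n + 1) * (cfQ θ n * θ - cfP θ n) := by
  induction n with
  | zero => simp [cfP, cfQ]
  | succ n ih =>
    rw [cfQ_mul_sub_cfP_succ hθ]
    have := mul_pos ih (irrational_cfTail hθ n).fract_pos
    rw [pow_succ]
    linarith

/-- With `r`, `s` consecutive denominators, `δ` and `ε` the corresponding errors, and `a` the next
coefficient, no lattice point below the line whose denominator `u * r + v * s` lies in
`[r, r + a * s)` beats the lower convergent, unless it is a multiple of it. -/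
theorem mul_le_of_denominator_between {r s a u v : ℤ} {δ ε : ℝ} (hr : 1 ≤ r) (hrs : r ≤ s)
    (hδ : 0 < δ) (hε : 0 < ε) (ha : a * ε < δ)
    (hle : r ≤ u * r + v * s) (hlt : u * r + v * s < r + a * s)
    (hnonneg : 0 ≤ u * δ - v * ε) (hv : v ≠ 0) :
    r * δ ≤ (u * r + v * s) * (u * δ - v * ε) := by
  have hu : 1 ≤ u := by
    by_contra! hu
    have hv0 : 1 ≤ v := by
      by_contra! hv0
      nlinarith [mul_nonneg (show 0 ≤ -u by linarith) (show 0 ≤ r by linarith),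
        mul_nonneg (show 0 ≤ -v by linarith) (show 0 ≤ s by linarith)]
    have hu' : (u : ℝ) ≤ 0 := by exact_mod_cast Int.lt_add_one_iff.1 hu
    have hv' : (1 : ℝ) ≤ v := by exact_mod_cast hv0
    nlinarith
  have hu' : (1 : ℝ) ≤ u := by exact_mod_cast hu
  have hr' : (1 : ℝ) ≤ r := by exact_mod_cast hr
  have hrs' : (r : ℝ) ≤ s := by exact_mod_cast hrs
  have hle' : (r : ℝ) ≤ u * r + v * s := by exact_mod_cast hle
  rcases lt_or_gt_of_ne hv with hneg | hpos
  · have hv' : (v : ℝ) ≤ 0 := by exact_mod_cast hneg.le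
    exact mul_le_mul hle' (by nlinarith) hδ.le (by linarith)
  · have hva : v + 1 ≤ a := by
      by_contra! hva
      nlinarith
    have hva' : (v : ℝ) + 1 ≤ a := by exact_mod_cast hva
    have hv' : (0 : ℝ) < v := by exact_mod_cast hpos
    have hδv : ε < δ - v * ε := by nlinarith
    have hstep : r * δ ≤ (r + v * s) * (δ - v * ε) := by
      have : 0 ≤ s * (δ - v * ε) - r * ε := by nlinarith
      nlinarith [mul_nonneg hv'.le this]
    refine hstep.trans (mul_le_mul ?_ ?_ ?_ ?_) <;> nlinarith

theorem exists_cfQ_le_lt {θ : ℝ} (hθ : Irrational θ) {q : ℤ} (hq : 0 < q) :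
    ∃ k : ℕ, cfQ θ (2 * k + 1) ≤ q ∧ q < cfQ θ (2 * k + 3) := by
  have hex : ∃ k : ℕ, q < cfQ θ (2 * k + 1) :=
    ⟨q.toNat, by simpa [Int.toNat_of_nonneg hq.le] using lt_cfQ_two_mul_add_one hθ q.toNat⟩
  classical
  obtain ⟨k, hk⟩ : ∃ k, Nat.find hex = k + 1 := by
    refine Nat.exists_eq_succ_of_ne_zero fun h0 => ?_
    have := Nat.find_spec hex
    rw [h0] at this
    simp only [cfQ] at this
    linarith
  refine ⟨k, not_lt.1 (Nat.find_min hex (by omega)), ?_⟩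
  have := Nat.find_spec hex
  rwa [hk] at this

theorem bestBelowThird_is_convergent (θ : ℝ) (hθpos : 0 < θ) (hθ : Irrational θ)
    (p q : ℤ) (h : IsBestBelowThird θ p q) :
    ∃ n : ℕ, (p : ℝ) / (q : ℝ) = (cfP θ (n + 1) : ℝ) / (cfQ θ (n + 1) : ℝ) := by
  obtain ⟨hq, hnonneg, hbest⟩ := h
  obtain ⟨k, hle, hlt⟩ := exists_cfQ_le_lt hθ hq
  refine ⟨2 * k, ?_⟩
  by_contra hne
  have hr := (cfQ_nonneg hθ (2 * k)).2
  have hrs := cfQ_le_succ hθ (2 * k)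
  have hδ := cfQ_mul_sub_cfP_sign hθ (2 * k + 1)
  have hε := cfQ_mul_sub_cfP_sign hθ (2 * k + 2)
  have hδ' := cfQ_mul_sub_cfP_sign hθ (2 * k + 3)
  have hdet := cfP_mul_cfQ_sub θ (2 * k + 1)
  rw [Even.neg_one_pow ⟨k + 1, by ring⟩, one_mul] at hδ
  rw [Odd.neg_one_pow ⟨k + 1, by ring⟩] at hε
  rw [Even.neg_one_pow ⟨k + 2, by ring⟩, one_mul] at hδ'
  rw [Even.neg_one_pow ⟨k + 1, by ring⟩] at hdet
  rw [cfQ] at hlt hδ'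
  rw [cfP] at hδ'
  push_cast at hδ'
  simp only [Nat.add_assoc, Nat.reduceAdd] at hr hrs hδ hε hδ' hdet hlt hle
  generalize cfA θ (2 * k + 2) = a at *
  generalize cfQ θ (2 * k + 1) = r at *
  generalize cfQ θ (2 * k + 2) = s at *
  generalize cfP θ (2 * k + 1) = x at *
  generalize cfP θ (2 * k + 2) = y at *
  have hq' : (0 : ℝ) < q := by exact_mod_cast hq
  have hr' : (0 : ℝ) < r := by exact_mod_cast hr
  have hdet' : (y * r - x * s : ℝ) = 1 := by exact_mod_cast hdet
  have hbelow : (x : ℝ) / r ≤ θ := by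
    rw [div_le_iff₀ hr']
    linarith
  have hlt' := hbest x r (by linarith) hle hbelow (Ne.symm hne)
  have hv : p * r - x * q ≠ 0 := by
    intro h0
    apply hne
    rw [div_eq_div_iff hq'.ne' hr'.ne']
    exact_mod_cast sub_eq_zero.1 h0
  have hqe : (q * y - p * s) * r + (p * r - x * q) * s = q := by
    linear_combination q * hdet
  have hqe' : ((q * y - p * s : ℤ) * r + (p * r - x * q : ℤ) * s : ℝ) = q := by exact_mod_cast hqe
  have herr : ((q * y - p * s : ℤ) * (r * θ - x) - (p * r - x * q : ℤ) * (y - s * θ) : ℝ)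
      = q * θ - p := by
    push_cast
    linear_combination (q * θ - p) * hdet'
  have hge := mul_le_of_denominator_between (r := r) (s := s) (a := a) (u := q * y - p * s)
    (v := p * r - x * q) (δ := r * θ - x) (ε := y - s * θ) hr hrs hδ (by linarith) (by linarith)
    (by rw [hqe]; exact hle) (by rw [hqe]; linarith)
    (by rw [herr]; exact nonneg_of_mul_nonneg_right hnonneg hq') hv
  rw [hqe', herr] at hge
  linarith
end

section
/- Let a, b > 0 with a/b irrational, and define F(k) := 2k·(tan(ka/2 − (π/2)⌊ka/π⌋) + tan(kb/2 − (π/2)⌊kb/π⌋)) for k > 0. Then: (1) F is strictly increasing on every open subinterval of (0, ∞) containing no point of the form mπ/a or mπ/b with m a positive integer; (2) F(k) → +∞ as k tends from the left to any point of the form mπ/a or mπ/b; (3) for every positive integer m, the right-hand limit of F at mπ/a equals (2mπ/a)·tan((π/2)·(m(b/a) − ⌊m(b/a)⌋)), and the right-hand limit of F at mπ/b equals (2mπ/b)·tan((π/2)·(m(a/b) − ⌊m(a/b)⌋)). -/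
open Real Filter Set

/-- The contribution of one edge length to the gap function, in the variable `x = k * a / π`. -/
noncomputable def gapTerm (x : ℝ) : ℝ := Real.tan (π / 2 * Int.fract x)

theorem tan_sub_floor_eq_gapTerm (k a : ℝ) :
    Real.tan (k * a / 2 - π / 2 * (⌊k * a / π⌋ : ℝ)) = gapTerm (k * a / π) := by
  unfold gapTerm Int.fract
  congr 1
  field_simp

theorem pi_div_two_mul_fract_lt (x : ℝ) : π / 2 * Int.fract x < π / 2 := by
  nlinarith [Int.fract_lt_one x, Real.pi_pos]

theorem pi_div_two_mul_fract_nonneg (x : ℝ) : 0 ≤ π / 2 * Int.fract x :=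
  mul_nonneg (by positivity) (Int.fract_nonneg x)

theorem gapTerm_nonneg (x : ℝ) : 0 ≤ gapTerm x :=
  Real.tan_nonneg_of_nonneg_of_le_pi_div_two (pi_div_two_mul_fract_nonneg x)
    (pi_div_two_mul_fract_lt x).le

theorem gapTerm_lt_gapTerm {x y : ℝ} (hxy : x < y) (hfloor : ⌊x⌋ = ⌊y⌋) :
    gapTerm x < gapTerm y := by
  refine Real.tan_lt_tan_of_nonneg_of_lt_pi_div_two (pi_div_two_mul_fract_nonneg x)
    (pi_div_two_mul_fract_lt y) ?_
  have : Int.fract x < Int.fract y := by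
    unfold Int.fract
    rw [hfloor]
    linarith
  gcongr

theorem continuousWithinAt_gapTerm_Ici (x : ℝ) : ContinuousWithinAt gapTerm (Ici x) x := by
  have hfloor : ∀ᶠ y in nhdsWithin x (Ici x), ⌊y⌋ = ⌊x⌋ := by
    filter_upwards [Ico_mem_nhdsGE (Int.lt_floor_add_one x)] with y hy
    exact Int.floor_eq_iff.2 ⟨(Int.floor_le x).trans hy.1, hy.2⟩
  have hcont : ContinuousAt (fun y : ℝ => Real.tan (π / 2 * (y - ⌊x⌋))) x := by
    refine ContinuousAt.comp (g := Real.tan) ?_ (by fun_prop)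
    refine Real.continuousAt_tan.2 (Real.cos_pos_of_mem_Ioo ⟨?_, ?_⟩).ne'
    · exact (by linarith [Real.pi_pos] : -(π / 2) < 0).trans_le (pi_div_two_mul_fract_nonneg x)
    · exact pi_div_two_mul_fract_lt x
  refine hcont.continuousWithinAt.congr_of_eventuallyEq ?_ rfl
  filter_upwards [hfloor] with y hy
  rw [gapTerm, Int.fract, hy]

theorem tendsto_gapTerm_left_atTop (n : ℤ) :
    Tendsto gapTerm (nhdsWithin (n : ℝ) (Iio (n : ℝ))) atTop := by
  refine Real.tendsto_tan_pi_div_two.comp (tendsto_nhdsWithin_iff.2 ⟨?_, ?_⟩)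
  · have h : Tendsto (Int.fract : ℝ → ℝ) (nhdsWithin (n : ℝ) (Iio (n : ℝ))) (nhds 1) :=
      tendsto_fract_left' n
    simpa using h.const_mul (π / 2)
  · exact Eventually.of_forall pi_div_two_mul_fract_lt

theorem tendsto_mul_div_pi_left {a : ℝ} (ha : 0 < a) (k : ℝ) :
    Tendsto (fun x : ℝ => x * a / π) (nhdsWithin k (Iio k))
      (nhdsWithin (k * a / π) (Iio (k * a / π))) := by
  refine tendsto_nhdsWithin_iff.2 ⟨?_, ?_⟩
  · exact (by fun_prop : Continuous fun x : ℝ => x * a / π).continuousWithinAt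
  · filter_upwards [self_mem_nhdsWithin] with x (hx : x < k)
    have := Real.pi_pos
    change x * a / π < k * a / π
    gcongr

theorem tendsto_mul_div_pi_right {a : ℝ} (ha : 0 < a) (k : ℝ) :
    Tendsto (fun x : ℝ => x * a / π) (nhdsWithin k (Ioi k))
      (nhdsWithin (k * a / π) (Ici (k * a / π))) := by
  refine tendsto_nhdsWithin_iff.2 ⟨?_, ?_⟩
  · exact (by fun_prop : Continuous fun x : ℝ => x * a / π).continuousWithinAt
  · filter_upwards [self_mem_nhdsWithin] with x (hx : k < x)
    have := Real.pi_pos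
    change k * a / π ≤ x * a / π
    gcongr

theorem mul_pi_div_mul_div_pi {a : ℝ} (ha : 0 < a) (m b : ℝ) :
    m * π / a * b / π = m * (b / a) := by
  field_simp

/-- The gap function with edge lengths `a` and `b`. -/
noncomputable def gapFunction (a b k : ℝ) : ℝ :=
  2 * k * (gapTerm (k * a / π) + gapTerm (k * b / π))

theorem gapFunction_comm (a b : ℝ) : gapFunction a b = gapFunction b a := by
  funext k
  rw [gapFunction, gapFunction, add_comm]

theorem floor_mul_div_pi_eq {a x y : ℝ} (ha : 0 < a) (hx : 0 < x) (hxy : x < y)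
    (h : ∀ m : ℕ, 0 < m → (m : ℝ) * π / a ∉ Ioc x y) : ⌊x * a / π⌋ = ⌊y * a / π⌋ := by
  have hπ := Real.pi_pos
  have hle : x * a / π ≤ y * a / π := by gcongr
  refine (Int.floor_le_floor hle).antisymm (not_lt.1 fun hlt => ?_)
  have hpos : 0 < ⌊y * a / π⌋ := (Int.floor_nonneg.2 (by positivity)).trans_lt hlt
  obtain ⟨m, hm⟩ := Int.eq_ofNat_of_zero_le hpos.le
  have hxm : x * a / π < m := by
    have := Int.floor_lt.1 hlt
    rw [hm] at this
    exact_mod_cast this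
  have hmy : (m : ℝ) ≤ y * a / π := by
    have := Int.floor_le (y * a / π)
    rw [hm] at this
    exact_mod_cast this
  refine h m (by omega) ⟨?_, ?_⟩
  · rw [lt_div_iff₀ ha]
    exact (div_lt_iff₀ hπ).1 hxm
  · rw [div_le_iff₀ ha]
    exact (le_div_iff₀ hπ).1 hmy

theorem strictMonoOn_gapFunction {a b s t : ℝ} (ha : 0 < a) (hb : 0 < b)
    (hpos : Ioo s t ⊆ Ioi (0 : ℝ))
    (h : ∀ m : ℕ, 0 < m → (m : ℝ) * π / a ∉ Ioo s t ∧ (m : ℝ) * π / b ∉ Ioo s t) :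
    StrictMonoOn (gapFunction a b) (Ioo s t) := by
  intro x hx y hy hxy
  have hx0 : 0 < x := hpos hx
  have hπ := Real.pi_pos
  have hsub : Ioc x y ⊆ Ioo s t := fun z hz => ⟨hx.1.trans hz.1, hz.2.trans_lt hy.2⟩
  have h₁ : gapTerm (x * a / π) < gapTerm (y * a / π) :=
    gapTerm_lt_gapTerm (by gcongr)
      (floor_mul_div_pi_eq ha hx0 hxy fun m hm hmem => (h m hm).1 (hsub hmem))
  have h₂ : gapTerm (x * b / π) < gapTerm (y * b / π) :=
    gapTerm_lt_gapTerm (by gcongr)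
      (floor_mul_div_pi_eq hb hx0 hxy fun m hm hmem => (h m hm).2 (hsub hmem))
  have h₀ : 0 ≤ gapTerm (x * a / π) + gapTerm (x * b / π) :=
    add_nonneg (gapTerm_nonneg _) (gapTerm_nonneg _)
  exact mul_lt_mul'' (by linarith) (add_lt_add h₁ h₂) (by positivity) h₀

theorem tendsto_gapFunction_left_atTop {a : ℝ} (ha : 0 < a) (b : ℝ) {m : ℕ} (hm : 0 < m) :
    Tendsto (gapFunction a b)
      (nhdsWithin ((m : ℝ) * π / a) (Iio ((m : ℝ) * π / a))) atTop := by
  have hm' : (0 : ℝ) < m := by exact_mod_cast hm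
  have hterm : Tendsto (fun k => gapTerm (k * a / π))
      (nhdsWithin ((m : ℝ) * π / a) (Iio ((m : ℝ) * π / a))) atTop := by
    have h := tendsto_mul_div_pi_left ha ((m : ℝ) * π / a)
    rw [mul_pi_div_mul_div_pi ha, div_self ha.ne', mul_one] at h
    exact (tendsto_gapTerm_left_atTop m).comp (by exact_mod_cast h)
  have hk : Tendsto (fun k : ℝ => 2 * k)
      (nhdsWithin ((m : ℝ) * π / a) (Iio ((m : ℝ) * π / a))) (nhds (2 * (m * π / a))) :=
    (by fun_prop : Continuous fun k : ℝ => 2 * k).continuousWithinAt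
  exact hk.pos_mul_atTop (by positivity)
    (tendsto_atTop_mono (fun k => le_add_of_nonneg_right (gapTerm_nonneg (k * b / π))) hterm)

theorem tendsto_gapFunction_right {a b : ℝ} (ha : 0 < a) (hb : 0 < b) (m : ℕ) :
    Tendsto (gapFunction a b)
      (nhdsWithin ((m : ℝ) * π / a) (Ioi ((m : ℝ) * π / a)))
      (nhds ((2 * m * π / a) *
        Real.tan (π / 2 * ((m : ℝ) * (b / a) - ⌊(m : ℝ) * (b / a)⌋)))) := by
  have hterm (c : ℝ) (hc : 0 < c) : Tendsto (fun k => gapTerm (k * c / π))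
      (nhdsWithin ((m : ℝ) * π / a) (Ioi ((m : ℝ) * π / a)))
      (nhds (gapTerm (m * (c / a)))) := by
    have h := (continuousWithinAt_gapTerm_Ici _).tendsto.comp
      (tendsto_mul_div_pi_right hc ((m : ℝ) * π / a))
    rwa [mul_pi_div_mul_div_pi ha] at h
  have hk : Tendsto (fun k : ℝ => 2 * k)
      (nhdsWithin ((m : ℝ) * π / a) (Ioi ((m : ℝ) * π / a))) (nhds (2 * (m * π / a))) :=
    (by fun_prop : Continuous fun k : ℝ => 2 * k).continuousWithinAt
  have hzero : gapTerm (m * (a / a)) = 0 := by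
    simp [gapTerm, div_self ha.ne']
  have h := hk.mul ((hterm a ha).add (hterm b hb))
  rwa [hzero, zero_add, gapTerm, Int.fract, ← mul_div_assoc, ← mul_assoc] at h

open Real Filter Set

theorem gap_function_properties (a b : ℝ) (ha : 0 < a) (hb : 0 < b)
    (hirr : Irrational (a / b)) :
    -- the function F
    let F : ℝ → ℝ := fun k =>
      2 * k * (Real.tan (k * a / 2 - π / 2 * (⌊k * a / π⌋ : ℝ)) +
        Real.tan (k * b / 2 - π / 2 * (⌊k * b / π⌋ : ℝ)))
    -- (1) strict monotonicity on intervals avoiding the singular points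
    (∀ s t : ℝ, Set.Ioo s t ⊆ Set.Ioi (0 : ℝ) →
      (∀ m : ℕ, 0 < m →
        (m : ℝ) * π / a ∉ Set.Ioo s t ∧ (m : ℝ) * π / b ∉ Set.Ioo s t) →
      StrictMonoOn F (Set.Ioo s t)) ∧
    -- (2) F tends to +∞ from the left at the singular points
    (∀ m : ℕ, 0 < m →
      Tendsto F (nhdsWithin ((m : ℝ) * π / a) (Set.Iio ((m : ℝ) * π / a))) atTop ∧
      Tendsto F (nhdsWithin ((m : ℝ) * π / b) (Set.Iio ((m : ℝ) * π / b))) atTop) ∧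
    -- (3) right-hand limits at the singular points
    (∀ m : ℕ, 0 < m →
      Tendsto F (nhdsWithin ((m : ℝ) * π / a) (Set.Ioi ((m : ℝ) * π / a)))
        (nhds ((2 * m * π / a) *
          Real.tan (π / 2 * ((m : ℝ) * (b / a) - ⌊(m : ℝ) * (b / a)⌋)))) ∧
      Tendsto F (nhdsWithin ((m : ℝ) * π / b) (Set.Ioi ((m : ℝ) * π / b)))
        (nhds ((2 * m * π / b) *
          Real.tan (π / 2 * ((m : ℝ) * (a / b) - ⌊(m : ℝ) * (a / b)⌋))))) := by
  intro F
  have hF : F = gapFunction a b := by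
    funext k
    simp only [F, gapFunction, tan_sub_floor_eq_gapTerm]
  rw [hF]
  refine ⟨fun s t hpos h => strictMonoOn_gapFunction ha hb hpos h,
    fun m hm => ⟨tendsto_gapFunction_left_atTop ha b hm, ?_⟩,
    fun m _ => ⟨tendsto_gapFunction_right ha hb m, ?_⟩⟩
  · rw [gapFunction_comm]
    exact tendsto_gapFunction_left_atTop hb a hm
  · rw [gapFunction_comm]
    exact tendsto_gapFunction_right hb ha m
end

section
/- Let a, b > 0 with θ = a/b irrational, and let α satisfy 0 < α < π²·min{υ(θ)/b, υ(θ⁻¹)/a}. Then only finitely many positive integers m satisfy (2mπ/a)·tan((π/2)·(mθ⁻¹ − ⌊mθ⁻¹⌋)) < α, and only finitely many positive integers m satisfy (2mπ/b)·tan((π/2)·(mθ − ⌊mθ⌋)) < α. -/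
open Real

/-- Infinitely many `m` with `m * fract (m * θ) < c` bound the one-sided Markov constant by `c`. -/
theorem upsilon_le_of_infinite {θ c : ℝ} (hθ : Irrational θ) (hc : 0 < c)
    (h : {m : ℕ | 0 < m ∧ m * Int.fract (m * θ) < c}.Infinite) : upsilon θ ≤ c := by
  refine csInf_le ⟨0, fun x hx => hx.1.le⟩ ⟨hc, ?_⟩
  have hinj : Function.Injective fun m : ℕ => ((⌊(m : ℝ) * θ⌋, (m : ℤ)) : ℤ × ℤ) :=
    fun m n hmn => by simpa using congrArg Prod.snd hmn
  refine (h.image hinj.injOn).mono ?_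
  rintro _ ⟨m, ⟨hm, hlt⟩, rfl⟩
  have hm' : (0 : ℝ) < m := by exact_mod_cast hm
  have hfract : 0 < Int.fract ((m : ℝ) * θ) :=
    Int.fract_pos.2 ((hθ.natCast_mul hm.ne').ne_int _)
  have heq : θ - (⌊(m : ℝ) * θ⌋ : ℝ) / m = Int.fract ((m : ℝ) * θ) / m := by
    rw [Int.fract]
    field_simp
  refine ⟨Int.natCast_ne_zero.2 hm.ne', ?_, ?_⟩
  · simp only [Int.cast_natCast, heq]
    positivity
  · simp only [Int.cast_natCast, heq]
    rw [div_lt_div_iff₀ hm' (by positivity)]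
    nlinarith

/-- Below `π ^ 2 * upsilon θ / L`, the gap condition holds for only finitely many `m`. -/
theorem finite_setOf_gap_condition {θ L α : ℝ} (hθ : Irrational θ) (hL : 0 < L) (hα : 0 < α)
    (hbound : α < π ^ 2 * (upsilon θ / L)) :
    {m : ℕ | 0 < m ∧ (2 * m * π / L) *
      Real.tan (π / 2 * ((m : ℝ) * θ - ⌊(m : ℝ) * θ⌋)) < α}.Finite := by
  by_contra hinf
  have hle : upsilon θ ≤ α * L / π ^ 2 := by
    refine upsilon_le_of_infinite hθ (by positivity) (Set.Infinite.mono ?_ hinf)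
    rintro m ⟨hm, hlt⟩
    refine ⟨hm, ?_⟩
    rw [Int.self_sub_floor] at hlt
    have htan : π / 2 * Int.fract ((m : ℝ) * θ) ≤ Real.tan (π / 2 * Int.fract ((m : ℝ) * θ)) :=
      Real.le_tan (mul_nonneg (by positivity) (Int.fract_nonneg _))
        (mul_lt_of_lt_one_right (by positivity) (Int.fract_lt_one _))
    have hmul := (mul_le_mul_of_nonneg_left htan
      (by positivity : 0 ≤ 2 * (m : ℝ) * π / L)).trans_lt hlt
    rw [lt_div_iff₀ (by positivity), ← div_lt_iff₀ hL]
    convert hmul using 1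
    ring
  rw [le_div_iff₀ (by positivity)] at hle
  rw [← mul_div_assoc, lt_div_iff₀ hL] at hbound
  linarith

theorem finitely_many_gaps_of_small_alpha (a b α : ℝ) (ha : 0 < a) (hb : 0 < b)
    (hirr : Irrational (a / b)) (hα : 0 < α)
    (hbound : α < π ^ 2 * min (upsilon (a / b) / b) (upsilon (a / b)⁻¹ / a)) :
    {m : ℕ | 0 < m ∧
        (2 * m * π / a) * Real.tan (π / 2 *
          ((m : ℝ) * (a / b)⁻¹ - ⌊(m : ℝ) * (a / b)⁻¹⌋)) < α}.Finite ∧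
    {m : ℕ | 0 < m ∧
        (2 * m * π / b) * Real.tan (π / 2 *
          ((m : ℝ) * (a / b) - ⌊(m : ℝ) * (a / b)⌋)) < α}.Finite := by
  exact ⟨finite_setOf_gap_condition hirr.inv ha hα
      (hbound.trans_le (mul_le_mul_of_nonneg_left (min_le_right _ _) (by positivity))),
    finite_setOf_gap_condition hirr hb hα
      (hbound.trans_le (mul_le_mul_of_nonneg_left (min_le_left _ _) (by positivity)))⟩
end

section
/- Let a, b > 0 with θ = a/b irrational, and set γ := min{inf over positive integers m of (2mπ/a)·tan((π/2)·(mθ⁻¹ − ⌊mθ⁻¹⌋)), inf over positive integers m of (2mπ/b)·tan((π/2)·(mθ − ⌊mθ⌋))}. If γ < α < π²·min{υ(θ)/b, υ(θ⁻¹)/a}, then the set of positive integers m satisfying (2mπ/a)·tan((π/2)·(mθ⁻¹ − ⌊mθ⁻¹⌋)) < α or (2mπ/b)·tan((π/2)·(mθ − ⌊mθ⌋)) < α is nonempty and finite. -/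
open Real

/-- Denominators `m` with `m * fract (m * θ)` bounded by a constant below `υ(θ)` are finite in
number. -/
theorem finite_mul_fract_lt_of_lt_upsilon {θ c : ℝ} (hθ : Irrational θ) (hc : c < upsilon θ) :
    {m : ℕ | 0 < m ∧ (m : ℝ) * Int.fract ((m : ℝ) * θ) < c}.Finite := by
  by_contra hinf
  rw [← Set.Infinite] at hinf
  have fract_pos : ∀ m : ℕ, 0 < m → 0 < Int.fract ((m : ℝ) * θ) := fun m hm =>
    Int.fract_pos.2 ((hθ.natCast_mul hm.ne').ne_int _)
  have hc0 : 0 < c := by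
    obtain ⟨m, hm, hlt⟩ := hinf.nonempty
    exact (mul_pos (Nat.cast_pos.2 hm) (fract_pos m hm)).trans hlt
  refine hc.not_ge (csInf_le ⟨0, fun x hx => hx.1.le⟩ ⟨hc0, ?_⟩)
  refine Set.infinite_of_injOn_mapsTo (f := fun m : ℕ => (⌊(m : ℝ) * θ⌋, (m : ℤ)))
    (fun m _ n _ h => by simpa using congrArg Prod.snd h) ?_ hinf
  rintro m ⟨hm, hlt⟩
  have hm' : (0 : ℝ) < m := Nat.cast_pos.2 hm
  have key : θ - (⌊(m : ℝ) * θ⌋ : ℝ) / m = Int.fract ((m : ℝ) * θ) / m := by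
    rw [Int.fract]
    field_simp
  simp only [Set.mem_ofPred_eq, Int.cast_natCast, key]
  refine ⟨by exact_mod_cast hm.ne', div_pos (fract_pos m hm) hm', ?_⟩
  rw [div_lt_div_iff₀ hm' (by positivity)]
  nlinarith

/-- Below the threshold `π² υ(θ) / a`, only finitely many `m` satisfy the gap condition. -/
theorem finite_tan_fract_lt_of_lt_upsilon {θ a α : ℝ} (ha : 0 < a) (hθ : Irrational θ)
    (hα : α < π ^ 2 * (upsilon θ / a)) :
    {m : ℕ | 0 < m ∧ (2 * m * π / a) * Real.tan (π / 2 *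
      ((m : ℝ) * θ - ⌊(m : ℝ) * θ⌋)) < α}.Finite := by
  have hπ := Real.pi_pos
  have hc : α * a / π ^ 2 < upsilon θ := by
    rw [div_lt_iff₀ (by positivity), ← lt_div_iff₀ ha]
    exact hα.trans_eq (by ring)
  refine (finite_mul_fract_lt_of_lt_upsilon hθ hc).subset ?_
  rintro m ⟨hm, hlt⟩
  refine ⟨hm, ?_⟩
  rw [Int.self_sub_floor] at hlt
  have htan : π / 2 * Int.fract ((m : ℝ) * θ) ≤ Real.tan (π / 2 * Int.fract ((m : ℝ) * θ)) :=
    Real.le_tan (mul_nonneg (by positivity) (Int.fract_nonneg _))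
      (mul_lt_of_lt_one_right (by positivity) (Int.fract_lt_one _))
  have h := (mul_le_mul_of_nonneg_left htan (by positivity : 0 ≤ 2 * (m : ℝ) * π / a)).trans_lt hlt
  rw [lt_div_iff₀ (by positivity), ← div_lt_iff₀ ha]
  exact lt_of_eq_of_lt (by ring) h

theorem bethe_sommerfeld_window_repulsive (a b α : ℝ) (ha : 0 < a) (hb : 0 < b)
    (hirr : Irrational (a / b))
    (hγ : (min
        (⨅ m : ℕ+, (2 * (m : ℕ) * π / a) * Real.tan (π / 2 *
          (((m : ℕ) : ℝ) * (a / b)⁻¹ - ⌊((m : ℕ) : ℝ) * (a / b)⁻¹⌋)))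
        (⨅ m : ℕ+, (2 * (m : ℕ) * π / b) * Real.tan (π / 2 *
          (((m : ℕ) : ℝ) * (a / b) - ⌊((m : ℕ) : ℝ) * (a / b)⌋)))) < α)
    (hbound : α < π ^ 2 * min (upsilon (a / b) / b) (upsilon (a / b)⁻¹ / a)) :
    {m : ℕ | 0 < m ∧
        ((2 * m * π / a) * Real.tan (π / 2 *
            ((m : ℝ) * (a / b)⁻¹ - ⌊(m : ℝ) * (a / b)⁻¹⌋)) < α ∨
          (2 * m * π / b) * Real.tan (π / 2 *
            ((m : ℝ) * (a / b) - ⌊(m : ℝ) * (a / b)⌋)) < α)}.Nonempty ∧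
    {m : ℕ | 0 < m ∧
        ((2 * m * π / a) * Real.tan (π / 2 *
            ((m : ℝ) * (a / b)⁻¹ - ⌊(m : ℝ) * (a / b)⁻¹⌋)) < α ∨
          (2 * m * π / b) * Real.tan (π / 2 *
            ((m : ℝ) * (a / b) - ⌊(m : ℝ) * (a / b)⌋)) < α)}.Finite := by
  have hπ : 0 < π ^ 2 := by positivity
  constructor
  · rcases min_lt_iff.1 hγ with h | h
    · obtain ⟨m, hm⟩ := exists_lt_of_ciInf_lt h
      exact ⟨m, m.pos, Or.inl hm⟩
    · obtain ⟨m, hm⟩ := exists_lt_of_ciInf_lt h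
      exact ⟨m, m.pos, Or.inr hm⟩
  · refine ((finite_tan_fract_lt_of_lt_upsilon ha hirr.inv
      (hbound.trans_le (mul_le_mul_of_nonneg_left (min_le_right _ _) hπ.le))).union
      (finite_tan_fract_lt_of_lt_upsilon hb hirr
      (hbound.trans_le (mul_le_mul_of_nonneg_left (min_le_left _ _) hπ.le)))).subset ?_
    rintro m ⟨hm, h | h⟩
    · exact Or.inl ⟨hm, h⟩
    · exact Or.inr ⟨hm, h⟩
end

section
/- Let a, b > 0 with θ = a/b irrational, and set γ := min{inf over positive integers m of (2mπ/a)·tan((π/2)·(⌈mθ⁻¹⌉ − mθ⁻¹)), inf over positive integers m of (2mπ/b)·tan((π/2)·(⌈mθ⌉ − mθ))}. If α < 0 and γ < |α| < π²·min{υ(θ⁻¹)/b, υ(θ)/a}, then the set of positive integers m satisfying (2mπ/a)·tan((π/2)·(⌈mθ⁻¹⌉ − mθ⁻¹)) < |α| or (2mπ/b)·tan((π/2)·(⌈mθ⌉ − mθ)) < |α| is nonempty and finite. -/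
open Real

/-- A threshold below the one-sided Markov constant of `t⁻¹` is undercut only finitely often. -/
theorem finite_tan_ceil_lt {t a A : ℝ} (ht : Irrational t) (ht0 : 0 < t) (ha : 0 < a)
    (hA : 0 < A) (h : A < π ^ 2 * (upsilon t⁻¹ / a)) :
    {m : ℕ | 0 < m ∧ (2 * m * π / a) * Real.tan (π / 2 *
      ((⌈(m : ℝ) * t⌉ : ℝ) - (m : ℝ) * t)) < A}.Finite := by
  by_contra hinf
  have hpi : 0 < π ^ 2 := by positivity
  have hB : A * a / π ^ 2 < upsilon t⁻¹ := by
    rw [div_lt_iff₀ hpi]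
    rw [← mul_div_assoc, lt_div_iff₀ ha] at h
    linarith
  obtain ⟨c, hBc, hc⟩ := exists_between hB
  set B := A * a / π ^ 2 with hBdef
  have hB0 : 0 < B := by positivity
  obtain ⟨M, hM⟩ := exists_nat_gt (B / (t * (c - B)))
  have htK : 0 < t * (c - B) := mul_pos ht0 (sub_pos.2 hBc)
  refine hc.not_ge (csInf_le ⟨0, fun x hx => hx.1.le⟩ ⟨hB0.trans hBc, ?_⟩)
  have hinf' := Set.Infinite.sdiff hinf (Set.finite_lt_nat M)
  refine (hinf'.image (f := fun m : ℕ => ((m : ℤ), ⌈(m : ℝ) * t⌉)) ?_).mono ?_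
  · intro x _ y _ hxy
    exact_mod_cast (Prod.mk.inj hxy).1
  · rintro _ ⟨m, ⟨⟨hm0, hm⟩, hmM⟩, rfl⟩
    have hm0' : (0 : ℝ) < m := by exact_mod_cast hm0
    have hMm : (M : ℝ) ≤ m := by exact_mod_cast not_lt.1 hmM
    have hδ0 : 0 < (⌈(m : ℝ) * t⌉ : ℝ) - m * t := by
      refine sub_pos.2 (lt_of_le_of_ne (Int.le_ceil _) ?_)
      exact (ht.natCast_mul hm0.ne').ne_int _
    have hδ1 : (⌈(m : ℝ) * t⌉ : ℝ) - m * t < 1 := by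
      linarith [Int.ceil_lt_add_one ((m : ℝ) * t)]
    set p : ℝ := (⌈(m : ℝ) * t⌉ : ℝ) with hp
    have htan : π / 2 * (p - m * t) < Real.tan (π / 2 * (p - m * t)) :=
      Real.lt_tan (by positivity) (by nlinarith [Real.pi_pos])
    have hδB : m * (p - m * t) < B := by
      have h1 := (mul_lt_mul_of_pos_left htan
        (show 0 < 2 * m * π / a by positivity)).trans hm
      have h2 : 2 * m * π / a * (π / 2 * (p - m * t)) = π ^ 2 * (m * (p - m * t)) / a := by
        field_simp
      rw [h2, div_lt_iff₀ ha] at h1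
      rw [hBdef, lt_div_iff₀ hpi]
      linarith
    have hBm : B < m * (t * (c - B)) := (div_lt_iff₀ htK).1 (hM.trans_le hMm)
    have hδK : p - m * t < t * (c - B) := lt_of_mul_lt_mul_left (hδB.trans hBm) hm0'.le
    have hp0 : 0 < p := by nlinarith [mul_pos hm0' ht0]
    have hdiff : t⁻¹ - m / p = (p - m * t) / (t * p) := by
      field_simp
    refine ⟨Int.cast_ne_zero.1 hp0.ne', ?_, ?_⟩
    · simp only [Int.cast_natCast, ← hp, hdiff]
      positivity
    · simp only [Int.cast_natCast, ← hp, hdiff]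
      rw [div_lt_div_iff₀ (by positivity) (by positivity)]
      have hkey : (p - m * t) * p < c * t := by
        nlinarith [mul_lt_mul_of_pos_left hδB ht0, mul_lt_mul_of_pos_left hδ1 hδ0]
      nlinarith [mul_lt_mul_of_pos_left hkey hp0]

theorem bethe_sommerfeld_window_attractive (a b α : ℝ) (ha : 0 < a) (hb : 0 < b)
    (hirr : Irrational (a / b)) (hα : α < 0)
    (hγ : (min
        (⨅ m : ℕ+, (2 * (m : ℕ) * π / a) * Real.tan (π / 2 *
          ((⌈((m : ℕ) : ℝ) * (a / b)⁻¹⌉ : ℝ) - ((m : ℕ) : ℝ) * (a / b)⁻¹)))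
        (⨅ m : ℕ+, (2 * (m : ℕ) * π / b) * Real.tan (π / 2 *
          ((⌈((m : ℕ) : ℝ) * (a / b)⌉ : ℝ) - ((m : ℕ) : ℝ) * (a / b))))) < |α|)
    (hbound : |α| < π ^ 2 * min (upsilon (a / b)⁻¹ / b) (upsilon (a / b) / a)) :
    {m : ℕ | 0 < m ∧
        ((2 * m * π / a) * Real.tan (π / 2 *
            ((⌈(m : ℝ) * (a / b)⁻¹⌉ : ℝ) - (m : ℝ) * (a / b)⁻¹)) < |α| ∨
          (2 * m * π / b) * Real.tan (π / 2 *
            ((⌈(m : ℝ) * (a / b)⌉ : ℝ) - (m : ℝ) * (a / b))) < |α|)}.Nonempty ∧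
    {m : ℕ | 0 < m ∧
        ((2 * m * π / a) * Real.tan (π / 2 *
            ((⌈(m : ℝ) * (a / b)⁻¹⌉ : ℝ) - (m : ℝ) * (a / b)⁻¹)) < |α| ∨
          (2 * m * π / b) * Real.tan (π / 2 *
            ((⌈(m : ℝ) * (a / b)⌉ : ℝ) - (m : ℝ) * (a / b))) < |α|)}.Finite := by
  have hA : 0 < |α| := abs_pos.2 hα.ne
  have hθ : 0 < a / b := div_pos ha hb
  constructor
  · rcases min_lt_iff.1 hγ with h | h
    · obtain ⟨m, hm⟩ := exists_lt_of_ciInf_lt h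
      exact ⟨m, m.pos, Or.inl hm⟩
    · obtain ⟨m, hm⟩ := exists_lt_of_ciInf_lt h
      exact ⟨m, m.pos, Or.inr hm⟩
  · have h1 := finite_tan_ceil_lt hirr.inv (inv_pos.2 hθ) ha hA (by
      rw [inv_inv]
      exact hbound.trans_le (by gcongr; exact min_le_right _ _))
    have h2 := finite_tan_ceil_lt hirr hθ hb hA
      (hbound.trans_le (by gcongr; exact min_le_left _ _))
    exact (h1.union h2).subset fun m hm => hm.2.imp (⟨hm.1, ·⟩) (⟨hm.1, ·⟩)
end

section
/- Let φ = (1 + √5)/2 be the golden mean. For every positive integer m, m·(mφ − ⌊mφ⌋) ≥ 1/√5. -/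
open Real

theorem golden_mean_floor_bound (m : ℕ) (hm : 0 < m) :
    (m : ℝ) * ((m : ℝ) * ((1 + Real.sqrt 5) / 2) -
        ⌊(m : ℝ) * ((1 + Real.sqrt 5) / 2)⌋) ≥ 1 / Real.sqrt 5 := by
  have hirr : Irrational ((m : ℝ) * ((1 + Real.sqrt 5) / 2)) :=
    Real.goldenRatio_irrational.natCast_mul hm.ne'
  have hlt := Int.lt_floor_add_one ((m : ℝ) * ((1 + Real.sqrt 5) / 2))
  have hle := (Int.floor_le ((m : ℝ) * ((1 + Real.sqrt 5) / 2))).lt_of_ne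
    (hirr.ne_int _).symm
  generalize ⌊(m : ℝ) * ((1 + Real.sqrt 5) / 2)⌋ = n at hlt hle ⊢
  have hs : Real.sqrt 5 * Real.sqrt 5 = 5 := Real.mul_self_sqrt (by norm_num)
  have hs1 : 1 < Real.sqrt 5 := Real.lt_sqrt_of_sq_lt (by norm_num)
  have hm1 : (1 : ℝ) ≤ m := by exact_mod_cast hm
  obtain ⟨d, hd⟩ : ∃ d, d = (m : ℝ) * ((1 + Real.sqrt 5) / 2) - n := ⟨_, rfl⟩
  have hd0 : 0 < d := by linarith
  have hpos : 0 < m * Real.sqrt 5 - d := by nlinarith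
  have hnorm : d * (m * Real.sqrt 5 - d) = ((m * m + m * n - n * n : ℤ) : ℝ) := by
    push_cast
    rw [hd]
    linear_combination (m * m / 4 : ℝ) * hs
  have hone : 1 ≤ d * (m * Real.sqrt 5 - d) := by
    have h := mul_pos hd0 hpos
    rw [hnorm] at h ⊢
    exact_mod_cast h
  rw [← hd, ge_iff_le, div_le_iff₀ (by linarith)]
  nlinarith [sq_nonneg d]
end

section
/- Let φ = (1 + √5)/2 be the golden mean. For every integer m ≥ 2, m·(⌈mφ⌉ − mφ) ≥ (1 − φ⁻⁸)/√5; in particular m·(⌈mφ⌉ − mφ) ≥ (2/π)·tan((3 − √5)π/4) for all integers m ≥ 2. -/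
open Real

/-- The value at `m = 3`, which is the minimum over `m ≥ 2`, in the form `a + b√5`. -/
lemma one_sub_golden_zpow_div_sqrt_five :
    (1 - ((1 + √5) / 2) ^ (-8 : ℤ)) / √5 = (21 - 9 * √5) / 2 := by
  have h5 : √5 ^ 2 = 5 := Real.sq_sqrt (by norm_num)
  have hpos : 0 < √5 := by positivity
  have hinv : ((1 + √5) / 2) ^ (-8 : ℤ) = (47 - 21 * √5) / 2 := by
    have hpow : ((1 + √5) / 2) ^ (8 : ℕ) = (47 + 21 * √5) / 2 := by
      have h2 : ((1 + √5) / 2) ^ 2 = (3 + √5) / 2 := by linear_combination h5 / 4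
      have h4 : ((1 + √5) / 2) ^ 4 = (7 + 3 * √5) / 2 := by
        linear_combination (((1 + √5) / 2) ^ 2 + (3 + √5) / 2) * h2 + h5 / 4
      linear_combination (((1 + √5) / 2) ^ 4 + (7 + 3 * √5) / 2) * h4 + 9 * h5 / 4
    rw [zpow_neg, show (8 : ℤ) = ((8 : ℕ) : ℤ) by norm_num, zpow_natCast, hpow]
    refine inv_eq_of_mul_eq_one_right ?_
    linear_combination -441 * h5 / 4
  rw [hinv, div_eq_iff hpos.ne']
  linear_combination 9 / 2 * h5

lemma mul_ceil_golden_sub_ge (m : ℤ) (hm : 2 ≤ m) :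
    (21 - 9 * √5) / 2 ≤
      (m : ℝ) * ((⌈(m : ℝ) * ((1 + √5) / 2)⌉ : ℝ) - (m : ℝ) * ((1 + √5) / 2)) := by
  have h5 : √5 ^ 2 = 5 := Real.sq_sqrt (by norm_num)
  have hlo : 2.236 < √5 := Real.lt_sqrt_of_sq_lt (by norm_num)
  have hceil : (m : ℝ) * ((1 + √5) / 2) ≤ ⌈(m : ℝ) * ((1 + √5) / 2)⌉ := Int.le_ceil _
  generalize ⌈(m : ℝ) * ((1 + √5) / 2)⌉ = n at hceil ⊢
  have hm' : (2 : ℝ) ≤ m := by exact_mod_cast hm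
  set δ : ℝ := n - m * ((1 + √5) / 2) with hδ
  have hδ0 : 0 ≤ δ := by linarith
  have hnorm : ((n ^ 2 - n * m - m ^ 2 : ℤ) : ℝ) = δ ^ 2 + √5 * (m * δ) := by
    push_cast
    rw [hδ]
    linear_combination (m : ℝ) ^ 2 / 4 * h5
  have hδpos : 0 < δ := by
    refine hδ0.lt_of_ne fun h => ?_
    have hirr : Irrational (√5) := by
      simpa using Nat.Prime.irrational_sqrt (p := 5) (by norm_num)
    refine hirr ⟨(2 * n - m) / m, ?_⟩
    push_cast
    rw [div_eq_iff (by positivity)]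
    linarith
  have hone : 1 ≤ δ ^ 2 + √5 * (m * δ) := by
    rw [← hnorm]
    have : (0 : ℝ) < ((n ^ 2 - n * m - m ^ 2 : ℤ) : ℝ) := by
      rw [hnorm]; positivity
    exact_mod_cast this
  by_contra! hlt
  have hδlo : (7 - 3 * √5) / 2 < δ := by
    refine lt_of_pow_lt_pow_left₀ 2 hδ0 ?_
    nlinarith
  have hm3 : m < 3 := by
    have : (m : ℝ) < 3 := by
      by_contra! h
      nlinarith
    exact_mod_cast this
  obtain rfl : m = 2 := by omega
  push_cast at hδ hlt
  have hn : (3 : ℝ) < n := by linarith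
  have hn' : (4 : ℝ) ≤ n := by exact_mod_cast (show 4 ≤ n from by exact_mod_cast hn)
  linarith

lemma two_div_pi_mul_tan_le :
    2 / π * Real.tan ((3 - √5) * π / 4) ≤ (21 - 9 * √5) / 2 := by
  have hlo : 2.23606 < √5 := Real.lt_sqrt_of_sq_lt (by norm_num)
  have hhi : √5 < 2.23607 := (Real.sqrt_lt' (by norm_num)).2 (by norm_num)
  have hπlo := Real.pi_gt_d4
  have hπhi := Real.pi_lt_d4
  have hmono : Real.tan ((3 - √5) * π / 4) < Real.tan (2 * 0.3001) :=
    Real.tan_lt_tan_of_lt_of_lt_pi_div_two (by nlinarith) (by linarith) (by nlinarith)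
  have hsin := (abs_le.1 (Real.sin_bound (x := 0.3001) (by norm_num [abs_le]))).2
  have hcos := (abs_le.1 (Real.cos_bound (x := 0.3001) (by norm_num [abs_le]))).1
  rw [abs_of_pos (by norm_num)] at hsin hcos
  have hcospos : 0 < Real.cos 0.3001 := by norm_num at hcos ⊢; linarith
  have htan : Real.tan 0.3001 ≤ 0.3102 := by
    rw [Real.tan_eq_sin_div_cos, div_le_iff₀ hcospos]
    norm_num at hsin hcos ⊢
    linarith
  have htan0 : 0 < Real.tan 0.3001 :=
    Real.tan_pos_of_pos_of_lt_pi_div_two (by norm_num) (by linarith)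
  have hdouble : Real.tan (2 * 0.3001) ≤ 0.687 := by
    rw [Real.tan_two_mul, div_le_iff₀ (by nlinarith)]
    nlinarith
  rw [div_mul_eq_mul_div, div_le_iff₀ Real.pi_pos]
  nlinarith

theorem golden_mean_ceil_bound (m : ℤ) (hm : 2 ≤ m) :
    (m : ℝ) * ((⌈(m : ℝ) * ((1 + Real.sqrt 5) / 2)⌉ : ℝ) -
        (m : ℝ) * ((1 + Real.sqrt 5) / 2))
      ≥ (1 - ((1 + Real.sqrt 5) / 2) ^ (-8 : ℤ)) / Real.sqrt 5 ∧
    (m : ℝ) * ((⌈(m : ℝ) * ((1 + Real.sqrt 5) / 2)⌉ : ℝ) -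
        (m : ℝ) * ((1 + Real.sqrt 5) / 2))
      ≥ (2 / π) * Real.tan ((3 - Real.sqrt 5) * π / 4) := by
  have h := mul_ceil_golden_sub_ge m hm
  exact ⟨one_sub_golden_zpow_div_sqrt_five.trans_le h, two_div_pi_mul_tan_le.trans h⟩
end

section
/- Let φ = (1 + √5)/2 be the golden mean and Fₙ the Fibonacci numbers (F₁ = F₂ = 1, Fₙ₊₁ = Fₙ + Fₙ₋₁). For every even positive integer n one has ⌈Fₙφ⌉ − Fₙφ = φ⁻ⁿ, and there exist infinitely many positive integers m (namely m = Fₙ for all sufficiently large even n) such that m·tan((π/2)·(⌈mφ⌉ − mφ)) < π/(2√5). -/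
open Real

lemma goldenConj_pow_eq_zpow_neg {n : ℕ} (hn : Even n) :
    goldenConj ^ n = goldenRatio ^ (-(n : ℤ)) := by
  rw [zpow_neg, zpow_natCast, ← inv_pow, inv_goldenRatio, hn.neg_pow]

lemma goldenConj_pow_pos {n : ℕ} (hn : Even n) : 0 < goldenConj ^ n :=
  hn.pow_pos goldenConj_ne_zero

lemma goldenConj_pow_lt_one {n : ℕ} (h0 : 0 < n) (hn : Even n) : goldenConj ^ n < 1 := by
  rw [← hn.neg_pow]
  exact pow_lt_one₀ (by linarith [goldenConj_neg]) (by linarith [neg_one_lt_goldenConj]) h0.ne'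

lemma goldenConj_pow_lt_quarter {n : ℕ} (h4 : 4 ≤ n) (hn : Even n) :
    goldenConj ^ n < 1 / 4 := by
  rw [← hn.neg_pow]
  have hlt : -goldenConj < 2 / 3 := by
    nlinarith [goldenConj_sq, goldenConj_neg]
  have h0 : 0 ≤ -goldenConj := by linarith [goldenConj_neg]
  calc (-goldenConj) ^ n ≤ (-goldenConj) ^ 4 :=
        pow_le_pow_of_le_one h0 (by linarith) h4
    _ ≤ (2 / 3) ^ 4 := by gcongr
    _ < 1 / 4 := by norm_num

lemma ceil_fib_mul_goldenRatio_sub {n : ℕ} (h0 : 0 < n) (hn : Even n) :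
    (⌈(Nat.fib n : ℝ) * goldenRatio⌉ : ℝ) - (Nat.fib n : ℝ) * goldenRatio = goldenConj ^ n := by
  have h := fib_succ_sub_goldenRatio_mul_fib n
  have hpos := goldenConj_pow_pos hn
  have hlt := goldenConj_pow_lt_one h0 hn
  have hc : ⌈(Nat.fib n : ℝ) * goldenRatio⌉ = (Nat.fib (n + 1) : ℤ) := by
    rw [Int.ceil_eq_iff]
    push_cast
    constructor <;> linarith
  rw [hc]
  push_cast
  linarith

/-- The upper Becker–Stark bound for the tangent, on a short interval. -/
lemma one_sub_sq_mul_tan_lt {t : ℝ} (h0 : 0 < t) (ht : t < 1 / 4) :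
    (1 - t ^ 2) * tan (π / 2 * t) < π / 2 * t := by
  have hπ := pi_pos
  have hπ' := pi_lt_d2
  obtain ⟨x, hx⟩ : ∃ x, x = π / 2 * t := ⟨_, rfl⟩
  rw [← hx]
  have hx0 : 0 < x := by rw [hx]; positivity
  have hx1 : x < 1 / 2 := by rw [hx]; nlinarith
  have hxt : 2 / 5 * x ^ 2 ≤ t ^ 2 := by
    rw [hx]
    have : π ^ 2 ≤ 10 := by nlinarith
    nlinarith [sq_nonneg t]
  have hsin : sin x ≤ x - x ^ 3 / 6 + x ^ 5 / 100 := by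
    have h := (abs_le.1 (sin_bound (x := x) (by rw [abs_of_pos hx0]; linarith))).2
    rw [abs_of_pos hx0] at h
    linarith
  have hcos := one_sub_sq_div_two_le_cos (x := x)
  have hcpos : 0 < cos x := cos_pos_of_mem_Ioo ⟨by linarith, by linarith [pi_gt_three]⟩
  have hspos : 0 < sin x := sin_pos_of_pos_of_lt_pi hx0 (by linarith [pi_gt_three])
  rw [tan_eq_sin_div_cos, ← mul_div_assoc, div_lt_iff₀ hcpos]
  have hx2 : x ^ 2 < 1 / 4 := by nlinarith
  calc (1 - t ^ 2) * sin x ≤ (1 - 2 / 5 * x ^ 2) * sin x := by gcongr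
    _ ≤ (1 - 2 / 5 * x ^ 2) * (x - x ^ 3 / 6 + x ^ 5 / 100) := by
        gcongr
        linarith
    _ < x * (1 - x ^ 2 / 2) := by
        have hq : 0 < x ^ 3 * (1 / 15 - x ^ 2 / 100 - x ^ 2 / 15 + x ^ 4 / 250) := by
          have : 0 < x ^ 4 := by positivity
          refine mul_pos (by positivity) ?_
          linarith
        linarith
    _ ≤ x * cos x := by gcongr

lemma fib_mul_tan_lt {n : ℕ} (h4 : 4 ≤ n) (hn : Even n) :
    (Nat.fib n : ℝ) * tan (π / 2 *
        ((⌈(Nat.fib n : ℝ) * goldenRatio⌉ : ℝ) - (Nat.fib n : ℝ) * goldenRatio))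
      < π / (2 * √5) := by
  rw [ceil_fib_mul_goldenRatio_sub (by omega) hn, coe_fib_eq]
  have hpos := goldenConj_pow_pos hn
  have key := one_sub_sq_mul_tan_lt hpos (goldenConj_pow_lt_quarter h4 hn)
  have hmul : goldenRatio ^ n * goldenConj ^ n = 1 := by
    rw [← mul_pow, goldenRatio_mul_goldenConj, hn.neg_one_pow]
  generalize goldenConj ^ n = t at *
  generalize goldenRatio ^ n = s at *
  have h : (s - t) * tan (π / 2 * t) < π / 2 := by
    refine lt_of_mul_lt_mul_right ?_ hpos.le
    calc (s - t) * tan (π / 2 * t) * t = (s * t - t ^ 2) * tan (π / 2 * t) := by ring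
      _ < π / 2 * t := by rwa [hmul]
  rw [div_mul_eq_mul_div, ← div_div]
  gcongr

theorem golden_mean_fibonacci_gap_condition :
    -- the golden mean
    let φ : ℝ := (1 + Real.sqrt 5) / 2
    -- (i) for every even positive n, ⌈Fₙφ⌉ − Fₙφ = φ⁻ⁿ
    (∀ n : ℕ, 0 < n → Even n →
      (⌈(Nat.fib n : ℝ) * φ⌉ : ℝ) - (Nat.fib n : ℝ) * φ = φ ^ (-(n : ℤ))) ∧
    -- (ii) m = Fₙ satisfies the gap inequality for all sufficiently large even n
    (∃ N : ℕ, ∀ n : ℕ, N ≤ n → Even n →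
      (Nat.fib n : ℝ) * Real.tan (π / 2 *
          ((⌈(Nat.fib n : ℝ) * φ⌉ : ℝ) - (Nat.fib n : ℝ) * φ))
        < π / (2 * Real.sqrt 5)) ∧
    -- (iii) hence infinitely many positive integers m satisfy the gap inequality
    {m : ℕ | 0 < m ∧
        (m : ℝ) * Real.tan (π / 2 * ((⌈(m : ℝ) * φ⌉ : ℝ) - (m : ℝ) * φ))
          < π / (2 * Real.sqrt 5)}.Infinite := by
  intro φ
  refine ⟨fun n h0 hn => ?_, ⟨4, fun n h4 hn => fib_mul_tan_lt h4 hn⟩, ?_⟩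
  · exact (ceil_fib_mul_goldenRatio_sub h0 hn).trans (goldenConj_pow_eq_zpow_neg hn)
  · refine Set.infinite_of_injective_forall_mem (f := fun k : ℕ => Nat.fib (2 * k + 2 + 2))
      (fun a b hab => ?_) fun k => ⟨Nat.fib_pos.2 (by omega),
        fib_mul_tan_lt (by omega) ⟨k + 2, by ring⟩⟩
    have := Nat.fib_add_two_strictMono.injective hab
    omega
end
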